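/- Fix finite nonempty sets S (states) and A (actions), a reward function r : S → A → ℝ, a transition kernel P : S → A → S → ℝ such that P(s,a,·) is a probability vector for every (s,a), a discount factor γ ∈ [0,1), a regularization parameter λ > 0, and R̄ ≥ 0 with |r(s,a)| ≤ R̄ for all (s,a). Let 0 < l ≤ 1 and δ ≥ 0. Let π₁, π₂ : S → A → ℝ be policies (each πᵢ(s,·) a probability vector) with π₁(s,a) ≥ l, π₂(s,a) ≥ l/2, and |π₁(s,a) − π₂(s,a)| ≤ δ for all (s,a). For i = 1, 2, suppose Qᵢ : S → A → ℝ and Vᵢ : S → ℝ satisfy the entropy-regularized Bellman equations for πᵢ: Qᵢ(s,a) = r(s,a) + γ·Σ_{s'} P(s,a,s')·Vᵢ(s') and Vᵢ(s) = Σ_a πᵢ(s,a)·Qᵢ(s,a) + λ·H(πᵢ(s,·)). Then for all s ∈ S: |V₁(s) − V₂(s)| ≤ ( δ·|A|·(R̄ + λ·log|A|)/(1−γ) + λ·δ·( |A|·log(1/l) + 2/l ) ) / (1−γ). -/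

import Mathlib

lemma abs_sum_mul_le_of_abs_le {ι : Type*} [Fintype ι] {p x : ι → ℝ} {M : ℝ}
    (hp : ∀ i, 0 ≤ p i) (hsum : ∑ i, p i = 1) (hx : ∀ i, |x i| ≤ M) :
    |∑ i, p i * x i| ≤ M := by
  calc |∑ i, p i * x i| ≤ ∑ i, |p i * x i| := Finset.abs_sum_le_sum_abs _ _
    _ ≤ ∑ i, p i * M := by
        refine Finset.sum_le_sum fun i _ => ?_
        rw [abs_mul, abs_of_nonneg (hp i)]
        exact mul_le_mul_of_nonneg_left (hx i) (hp i)
    _ = M := by rw [← Finset.sum_mul, hsum, one_mul]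

/-- A function on a finite set satisfying a self-improving affine bound with contraction factor
`γ < 1` is bounded by the fixed point of the affine map. -/
lemma le_div_one_sub_of_contracting_bound {S : Type*} [Finite S] {γ c : ℝ} (hγ : γ < 1)
    {f : S → ℝ} (h : ∀ M, (∀ s, f s ≤ M) → ∀ s, f s ≤ γ * M + c) (s : S) :
    f s ≤ c / (1 - γ) := by
  have : Nonempty S := ⟨s⟩
  obtain ⟨t, ht⟩ := Finite.exists_max f
  have h1 := h (f t) ht t
  refine (ht s).trans ?_
  rw [le_div_iff₀ (by linarith)]
  linarith

lemma abs_entropy_le_log_card {A : Type*} [Fintype A] {p : A → ℝ}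
    (hp : ∀ a, 0 < p a) (hsum : ∑ a, p a = 1) :
    |-∑ a, p a * Real.log (p a)| ≤ Real.log (Fintype.card A) := by
  have hne : Nonempty A := by
    by_contra h
    rw [not_nonempty_iff] at h
    simp at hsum
  have hn : (0 : ℝ) < Fintype.card A := by exact_mod_cast Fintype.card_pos
  have hle : ∀ a, p a ≤ 1 := fun a =>
    hsum ▸ Finset.single_le_sum (fun b _ => (hp b).le) (Finset.mem_univ a)
  have hneg : ∑ a, p a * Real.log (p a) ≤ 0 := Finset.sum_nonpos fun a _ =>
    mul_nonpos_of_nonneg_of_nonpos (hp a).le (Real.log_nonpos (hp a).le (hle a))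
  rw [abs_of_nonneg (by linarith)]
  have key : ∀ a, -(p a * Real.log (p a)) - p a * Real.log (Fintype.card A)
      ≤ 1 / (Fintype.card A : ℝ) - p a := fun a => by
    have h := Real.log_le_sub_one_of_pos (inv_pos.2 (mul_pos hn (hp a)))
    rw [Real.log_inv, Real.log_mul hn.ne' (hp a).ne'] at h
    have h2 := mul_le_mul_of_nonneg_left h (hp a).le
    have h3 : p a * (((Fintype.card A : ℝ) * p a)⁻¹ - 1) = 1 / (Fintype.card A : ℝ) - p a := by
      have := (hp a).ne'
      field_simp
    linarith
  have h := Finset.sum_le_sum fun a (_ : a ∈ Finset.univ) => key a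
  simp only [Finset.sum_sub_distrib, Finset.sum_neg_distrib, ← Finset.sum_mul, hsum,
    Finset.sum_const, Finset.card_univ, nsmul_eq_mul] at h
  rw [mul_one_div_cancel hn.ne'] at h
  linarith

lemma abs_log_sub_log_le {x y m : ℝ} (hm : 0 < m) (hx : m ≤ x) (hy : m ≤ y) :
    |Real.log x - Real.log y| ≤ |x - y| / m := by
  have key : ∀ {u v : ℝ}, m ≤ u → m ≤ v → Real.log u - Real.log v ≤ |u - v| / m := by
    intro u v hu hv
    have hu0 := hm.trans_le hu
    have hv0 := hm.trans_le hv
    rw [← Real.log_div hu0.ne' hv0.ne']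
    calc Real.log (u / v) ≤ u / v - 1 := Real.log_le_sub_one_of_pos (div_pos hu0 hv0)
      _ = (u - v) / v := by field_simp
      _ ≤ |u - v| / v := by gcongr; exact le_abs_self _
      _ ≤ |u - v| / m := by gcongr
  rw [abs_le]
  have := key hy hx
  rw [abs_sub_comm] at this
  exact ⟨by linarith, key hx hy⟩

lemma abs_entropy_sub_entropy_le {A : Type*} [Fintype A] {p q : A → ℝ} {l δ : ℝ}
    (hl : 0 < l) (hp : ∀ a, l ≤ p a) (hq : ∀ a, l / 2 ≤ q a)
    (hpsum : ∑ a, p a = 1) (hqsum : ∑ a, q a = 1) (hclose : ∀ a, |p a - q a| ≤ δ) :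
    |(-∑ a, p a * Real.log (p a)) - (-∑ a, q a * Real.log (q a))| ≤
      δ * (Fintype.card A * Real.log (1 / l) + 2 / l) := by
  have hq0 : ∀ a, 0 ≤ q a := fun a => by linarith [hq a]
  have hsplit : (-∑ a, p a * Real.log (p a)) - (-∑ a, q a * Real.log (q a)) =
      ∑ a, q a * (Real.log (q a) - Real.log (p a)) -
        ∑ a, (p a - q a) * Real.log (p a) := by
    simp only [mul_sub, sub_mul, Finset.sum_sub_distrib]
    ring
  have hfirst : |∑ a, q a * (Real.log (q a) - Real.log (p a))| ≤ δ / (l / 2) := by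
    refine abs_sum_mul_le_of_abs_le hq0 hqsum fun a => ?_
    have h := abs_log_sub_log_le (half_pos hl) (hq a) (show l / 2 ≤ p a by linarith [hp a])
    rw [abs_sub_comm (q a)] at h
    exact h.trans (by gcongr; exact hclose a)
  have hsecond : |∑ a, (p a - q a) * Real.log (p a)| ≤
      Fintype.card A * (δ * Real.log (1 / l)) := by
    rw [← nsmul_eq_mul, ← Finset.card_univ]
    refine (Finset.abs_sum_le_sum_abs _ _).trans (Finset.sum_le_card_nsmul _ _ _ fun a _ => ?_)
    have hpa : p a ≤ 1 := hpsum ▸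
      Finset.single_le_sum (fun b _ => hl.le.trans (hp b)) (Finset.mem_univ a)
    have hlog : |Real.log (p a)| ≤ Real.log (1 / l) := by
      rw [abs_of_nonpos (Real.log_nonpos (hl.le.trans (hp a)) hpa), one_div, Real.log_inv]
      exact neg_le_neg (Real.log_le_log hl (hp a))
    rw [abs_mul]
    exact mul_le_mul (hclose a) hlog (abs_nonneg _) ((abs_nonneg _).trans (hclose a))
  rw [hsplit]
  calc _ ≤ _ := abs_sub _ _
    _ ≤ δ / (l / 2) + Fintype.card A * (δ * Real.log (1 / l)) := add_le_add hfirst hsecond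
    _ = _ := by field_simp; ring

lemma abs_action_value_le {S A : Type*} [Fintype S] [Fintype A] [Nonempty A]
    {r : S → A → ℝ} {P : S → A → S → ℝ} (hP_nonneg : ∀ s a s', 0 ≤ P s a s')
    (hP_sum : ∀ s a, ∑ s', P s a s' = 1) {γ : ℝ} (hγ : γ ∈ Set.Ico (0 : ℝ) 1)
    {lam : ℝ} (hlam : 0 ≤ lam) {Rbar : ℝ} (hr : ∀ s a, |r s a| ≤ Rbar)
    {pol : S → A → ℝ} (hpol : ∀ s a, 0 < pol s a) (hpol_sum : ∀ s, ∑ a, pol s a = 1)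
    {Q : S → A → ℝ} {V : S → ℝ} (hQ : ∀ s a, Q s a = r s a + γ * ∑ s', P s a s' * V s')
    (hV : ∀ s, V s = ∑ a, pol s a * Q s a +
      lam * (-∑ a, pol s a * Real.log (pol s a))) (s : S) (a : A) :
    |Q s a| ≤ (Rbar + lam * Real.log (Fintype.card A)) / (1 - γ) := by
  have hQM : ∀ M, (∀ s, |V s| ≤ M) → ∀ s a, |Q s a| ≤ Rbar + γ * M := fun M hM s a => by
    rw [hQ]
    refine (abs_add_le _ _).trans (add_le_add (hr s a) ?_)
    rw [abs_mul, abs_of_nonneg hγ.1]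
    exact mul_le_mul_of_nonneg_left
      (abs_sum_mul_le_of_abs_le (hP_nonneg s a) (hP_sum s a) hM) hγ.1
  have hVM := le_div_one_sub_of_contracting_bound (f := fun s => |V s|)
    (c := Rbar + lam * Real.log (Fintype.card A)) hγ.2 fun M hM s => by
      have h1 := abs_sum_mul_le_of_abs_le (fun a => (hpol s a).le) (hpol_sum s) (hQM M hM s)
      have h2 := mul_le_mul_of_nonneg_left
        (abs_entropy_le_log_card (hpol s) (hpol_sum s)) hlam
      rw [← abs_of_nonneg hlam, ← abs_mul, abs_of_nonneg hlam] at h2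
      have h3 := abs_add_le (∑ a, pol s a * Q s a) (lam * (-∑ a, pol s a * Real.log (pol s a)))
      rw [← hV s] at h3
      linarith
  have h := hQM _ hVM s a
  have hpos : 0 ≤ lam * Real.log (Fintype.card A) :=
    mul_nonneg hlam (Real.log_natCast_nonneg _)
  have hfix : (1 - γ) * ((Rbar + lam * Real.log (Fintype.card A)) / (1 - γ)) =
      Rbar + lam * Real.log (Fintype.card A) :=
    mul_div_cancel₀ _ (by linarith [hγ.2])
  linarith



/-- Bound on the difference of entropy-regularized value functions of two nearby
policies that are bounded away from zero (intermediate estimate in the bias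
analysis of Theorem 4.3). -/
theorem value_difference_of_close_policies
    {S A : Type*} [Fintype S] [Nonempty S] [Fintype A] [Nonempty A]
    (r : S → A → ℝ) (P : S → A → S → ℝ)
    (hP_nonneg : ∀ s a s', 0 ≤ P s a s')
    (hP_sum : ∀ s a, ∑ s', P s a s' = 1)
    (γ : ℝ) (hγ : γ ∈ Set.Ico (0 : ℝ) 1) (lam : ℝ) (hlam : 0 < lam)
    (Rbar : ℝ) (hRbar : 0 ≤ Rbar) (hr : ∀ s a, |r s a| ≤ Rbar)
    (l : ℝ) (hl0 : 0 < l) (hl1 : l ≤ 1) (δ : ℝ) (hδ : 0 ≤ δ)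
    (pol₁ pol₂ : S → A → ℝ)
    (hpol₁l : ∀ s a, l ≤ pol₁ s a) (hpol₂l : ∀ s a, l / 2 ≤ pol₂ s a)
    (hpol₁sum : ∀ s, ∑ a, pol₁ s a = 1) (hpol₂sum : ∀ s, ∑ a, pol₂ s a = 1)
    (hclose : ∀ s a, |pol₁ s a - pol₂ s a| ≤ δ)
    (Q₁ Q₂ : S → A → ℝ) (V₁ V₂ : S → ℝ)
    (hQ₁ : ∀ s a, Q₁ s a = r s a + γ * ∑ s', P s a s' * V₁ s')
    (hV₁ : ∀ s, V₁ s = ∑ a, pol₁ s a * Q₁ s a +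
      lam * (-∑ a, pol₁ s a * Real.log (pol₁ s a)))
    (hQ₂ : ∀ s a, Q₂ s a = r s a + γ * ∑ s', P s a s' * V₂ s')
    (hV₂ : ∀ s, V₂ s = ∑ a, pol₂ s a * Q₂ s a +
      lam * (-∑ a, pol₂ s a * Real.log (pol₂ s a))) :
    ∀ s, |V₁ s - V₂ s| ≤
      (δ * (Fintype.card A) * (Rbar + lam * Real.log (Fintype.card A)) / (1 - γ)
        + lam * δ * ((Fintype.card A) * Real.log (1 / l) + 2 / l)) / (1 - γ) := by
  refine le_div_one_sub_of_contracting_bound (f := fun s => |V₁ s - V₂ s|) hγ.2 fun M hM s => ?_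
  have hQ₂bound := abs_action_value_le hP_nonneg hP_sum hγ hlam.le hr
    (fun s a => (half_pos hl0).trans_le (hpol₂l s a)) hpol₂sum hQ₂ hV₂ s
  have hQdiff : ∀ a, |Q₁ s a - Q₂ s a| ≤ γ * M := fun a => by
    have heq : Q₁ s a - Q₂ s a = γ * ∑ s', P s a s' * (V₁ s' - V₂ s') := by
      simp only [hQ₁, hQ₂, mul_sub, Finset.sum_sub_distrib]
      ring
    rw [heq, abs_mul, abs_of_nonneg hγ.1]
    exact mul_le_mul_of_nonneg_left
      (abs_sum_mul_le_of_abs_le (hP_nonneg s a) (hP_sum s a) hM) hγ.1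
  have hcontract := abs_sum_mul_le_of_abs_le (fun a => hl0.le.trans (hpol₁l s a))
    (hpol₁sum s) hQdiff
  have hpolicy : |∑ a, (pol₁ s a - pol₂ s a) * Q₂ s a| ≤ Fintype.card A *
      (δ * ((Rbar + lam * Real.log (Fintype.card A)) / (1 - γ))) := by
    rw [← nsmul_eq_mul, ← Finset.card_univ]
    refine (Finset.abs_sum_le_sum_abs _ _).trans (Finset.sum_le_card_nsmul _ _ _ fun a _ => ?_)
    rw [abs_mul]
    exact mul_le_mul (hclose s a) (hQ₂bound a) (abs_nonneg _) hδ
  have hentropy := mul_le_mul_of_nonneg_left (abs_entropy_sub_entropy_le hl0 (hpol₁l s)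
    (hpol₂l s) (hpol₁sum s) (hpol₂sum s) (hclose s)) hlam.le
  rw [← abs_of_nonneg hlam.le, ← abs_mul, abs_of_nonneg hlam.le] at hentropy
  have hsplit : V₁ s - V₂ s = ∑ a, pol₁ s a * (Q₁ s a - Q₂ s a) +
      ∑ a, (pol₁ s a - pol₂ s a) * Q₂ s a +
      lam * ((-∑ a, pol₁ s a * Real.log (pol₁ s a)) -
        (-∑ a, pol₂ s a * Real.log (pol₂ s a))) := by
    rw [hV₁ s, hV₂ s]
    simp only [mul_sub, sub_mul, Finset.sum_sub_distrib]
    ring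
  calc |V₁ s - V₂ s| ≤ _ := hsplit ▸ abs_add_three _ _ _
    _ ≤ _ := add_le_add (add_le_add hcontract hpolicy) hentropy
    _ = _ := by ring
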